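/- Let ε = 1 or ε = −1, b ∈ ℝ with εb > 0, a ∈ ℂ, and let S ⊆ ℂ ∖ {0} be open. Let u : ℂ → ℂ be analytic on S with u(τ) ≠ 0 for all τ ∈ S, and suppose u satisfies the degenerate third Painlevé equation dP3(a, ε, b) on S. Define u₊(τ) := −(iεb/(8·u(τ)²))·(τ·(u'(τ) + ib) + (2ai − 1)·u(τ)). Then the 2-node differential-difference relation holds: for all τ ∈ S, (d/dτ)[u(τ)·u₊(τ)] + ib·(u₊(τ) − u(τ)) = 0. -/

import Mathlib

open Complex

/-- The degenerate third Painlevé equation `dP3(a, ε, b)` at the point `τ`. -/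
def IsDP3At (a : ℂ) (ε b : ℝ) (u : ℂ → ℂ) (τ : ℂ) : Prop :=
  deriv (deriv u) τ =
    (deriv u τ) ^ 2 / u τ - deriv u τ / τ +
      (-8 * (ε : ℂ) * (u τ) ^ 2 + 2 * a * (b : ℂ)) / τ + (b : ℂ) ^ 2 / u τ

/-- The 2-node differential-difference relation (2.9):
`(u·u₊)' + ib·(u₊ − u) = 0` for the Bäcklund transform `u₊` of a solution `u`. -/
theorem two_node_relation
    (ε b : ℝ) (hε : ε = 1 ∨ ε = -1) (hεb : ε * b > 0) (a : ℂ)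
    (S : Set ℂ) (hS : IsOpen S) (hS0 : S ⊆ {(0 : ℂ)}ᶜ)
    (u : ℂ → ℂ)
    (hu : ∀ τ ∈ S, AnalyticAt ℂ u τ)
    (hune : ∀ τ ∈ S, u τ ≠ 0)
    (heq : ∀ τ ∈ S, IsDP3At a ε b u τ)
    (up : ℂ → ℂ)
    (hup : ∀ τ, up τ = -(I * (ε : ℂ) * (b : ℂ) / (8 * (u τ) ^ 2)) *
      (τ * (deriv u τ + I * (b : ℂ)) + (2 * a * I - 1) * u τ)) :
    ∀ τ ∈ S, deriv (fun s => u s * up s) τ + I * (b : ℂ) * (up τ - u τ) = 0 := by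
  intro τ hτ
  have hτ0 : τ ≠ 0 := hS0 hτ
  have h0 : u τ ≠ 0 := hune τ hτ
  have hε2 : (ε : ℂ) ^ 2 = 1 := by rcases hε with rfl | rfl <;> simp
  have hu1 : HasDerivAt u (deriv u τ) τ := (hu τ hτ).differentiableAt.hasDerivAt
  have hu2 : HasDerivAt (deriv u) (deriv (deriv u) τ) τ :=
    (hu τ hτ).deriv.differentiableAt.hasDerivAt
  have hev : (fun s => u s * up s) =ᶠ[nhds τ] fun s =>
      -(I * (ε : ℂ) * (b : ℂ) / 8) *
        (s * (deriv u s + I * (b : ℂ)) / u s + (2 * a * I - 1)) := by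
    filter_upwards [hS.mem_nhds hτ] with s hs
    have := hune s hs
    rw [hup]
    field_simp
  have hF := ((((hasDerivAt_id' τ).mul (hu2.add_const (I * (b : ℂ)))).div hu1 h0).add_const
    (2 * a * I - 1)).const_mul (-(I * (ε : ℂ) * (b : ℂ) / 8))
  have hderiv := hev.deriv_eq.trans hF.deriv
  have hode := heq τ hτ
  unfold IsDP3At at hode
  rw [hderiv, hup, hode]
  simp only [Pi.mul_apply]
  field_simp
  ring_nf
  simp only [I_pow_three, hε2]
  ring
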